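/- Stay move removal preserves semantics: let M be a terminating MFT and q a non-initial state of rank m+1 all of whose rules (the ε-rule and the default rule, with no σ-rules) have the same right-hand side r in which neither x₁ nor x₂ occurs. Let M' be obtained from M by deleting the state q and its rules and replacing, in every remaining right-hand side, each call q(x_i, e₁, …, e_m) by r with x₀ replaced by x_i and each y_j replaced by e_j. Then ⟦M'⟧ = ⟦M⟧. -/

import Mathlib

set_option autoImplicit true
set_option maxHeartbeats 1000000

/-! ## XML forests (in first-child next-sibling style, also serving as binary XML trees) -/

/-- Node types: element, attribute, text nodes. -/
inductive NodeKind where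
  | elem | attr | text
deriving DecidableEq, Repr

/-- Nonempty words over the universal alphabet `U` (= `Char`). -/
abbrev Word : Type := {w : List Char // w ≠ []}

/-- A node label: a type together with a name (a nonempty word over `U`). -/
abbrev Label : Type := NodeKind × Word

/-- XML forests; `node l c r` is a tree with root label `l`, children forest `c`,
followed by the forest `r` of further trees of the sequence.  Under the
first-child next-sibling correspondence this type also represents binary XML
trees (with `eps` the ε-leaves and every labeled node binary), and the
encoding `fcns` is the identity of this representation. -/
inductive Forest where
  | eps : Forest
  | node : Label → Forest → Forest → Forest
deriving DecidableEq, Repr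

namespace Forest

/-- Concatenation of forests. -/
def append : Forest → Forest → Forest
  | .eps, g => g
  | .node l c r, g => .node l c (append r g)

/-- The size of a forest = its number of nodes. -/
def size : Forest → ℕ
  | .eps => 0
  | .node _ c r => 1 + c.size + r.size

/-- Height of a binary XML tree (length of the longest root-to-leaf path). -/
def height : Forest → ℕ
  | .eps => 0
  | .node _ c r => 1 + max c.height r.height

/-- All labels of the forest belong to `S`. -/
def labelsIn (S : Finset Label) : Forest → Prop
  | .eps => True
  | .node l c r => l ∈ S ∧ c.labelsIn S ∧ r.labelsIn S

end Forest

/-! ## Macro forest transducers -/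

/-- Input variables: `x0` binds the current node together with the rest of the
stream, `x1` the children of the current node, `x2` the rest of the stream. -/
inductive XVar where
  | x0 | x1 | x2
deriving DecidableEq, Repr

def XVar.sel : XVar → Forest → Forest → Forest → Forest
  | .x0, g0, _, _ => g0
  | .x1, _, g1, _ => g1
  | .x2, _, _, g2 => g2

/-- Right-hand sides of MFT rules: forests over `Σ ∪ Q ∪ {x0,x1,x2} ∪ Y`,
where a leaf is labeled by an input variable exactly if it is the first child of
a state-labeled node (constructor `call`), parameters occur only at leaves
(constructor `param`, with the remainder of the forest sequence), and `tnode`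
is a `%t`-labeled node (only allowed in default rules). -/
inductive RHS (Q : Type) where
  | eps   : RHS Q
  | node  : Label → RHS Q → RHS Q → RHS Q
  | tnode : RHS Q → RHS Q → RHS Q
  | param : ℕ → RHS Q → RHS Q
  | call  : Q → XVar → List (RHS Q) → RHS Q → RHS Q

namespace RHS

/-- Number of nodes of a right-hand side. -/
def size : RHS Q → ℕ
  | .eps => 0
  | .node _ c r => 1 + c.size + r.size
  | .tnode c r => 1 + c.size + r.size
  | .param _ r => 1 + r.size
  | .call _ _ args r => 1 + (args.attach.map (fun a => a.1.size)).sum + r.size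
decreasing_by
  all_goals simp_wf
  all_goals try omega
  all_goals (have := List.sizeOf_lt_of_mem a.2; omega)


/-- Concatenation of right-hand-side forests. -/
def append : RHS Q → RHS Q → RHS Q
  | .eps, t => t
  | .node l c r, t => .node l c (r.append t)
  | .tnode c r, t => .tnode c (r.append t)
  | .param j r, t => .param j (r.append t)
  | .call p x as r, t => .call p x as (r.append t)

mutual
/-- All calls in the right-hand side use only the input variable `x0`. -/
def varsOnly0 : RHS Q → Prop
  | .eps => True
  | .node _ c r => c.varsOnly0 ∧ r.varsOnly0
  | .tnode c r => c.varsOnly0 ∧ r.varsOnly0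
  | .param _ r => r.varsOnly0
  | .call _ x args r => x = .x0 ∧ varsOnly0L args ∧ r.varsOnly0
def varsOnly0L : List (RHS Q) → Prop
  | [] => True
  | a :: as => a.varsOnly0 ∧ varsOnly0L as
end

mutual
/-- No `%t`-labeled node occurs. -/
def noT : RHS Q → Prop
  | .eps => True
  | .node _ c r => c.noT ∧ r.noT
  | .tnode _ _ => False
  | .param _ r => r.noT
  | .call _ _ args r => noTL args ∧ r.noT
def noTL : List (RHS Q) → Prop
  | [] => True
  | a :: as => a.noT ∧ noTL as
end

mutual
/-- All labels of the right-hand side belong to `S`. -/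
def labelsIn (S : Finset Label) : RHS Q → Prop
  | .eps => True
  | .node l c r => l ∈ S ∧ c.labelsIn S ∧ r.labelsIn S
  | .tnode c r => c.labelsIn S ∧ r.labelsIn S
  | .param _ r => r.labelsIn S
  | .call _ _ args r => labelsInL S args ∧ r.labelsIn S
def labelsInL (S : Finset Label) : List (RHS Q) → Prop
  | [] => True
  | a :: as => a.labelsIn S ∧ labelsInL S as
end

mutual
/-- Ranks are respected: every state call `q` carries exactly `prm q` parameter
arguments and the parameters used are among `y₁,…,y_m`. -/
def arityOK (prm : Q → ℕ) (m : ℕ) : RHS Q → Prop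
  | .eps => True
  | .node _ c r => c.arityOK prm m ∧ r.arityOK prm m
  | .tnode c r => c.arityOK prm m ∧ r.arityOK prm m
  | .param j r => j < m ∧ r.arityOK prm m
  | .call q _ args r => args.length = prm q ∧ arityOKL prm m args ∧ r.arityOK prm m
def arityOKL (prm : Q → ℕ) (m : ℕ) : List (RHS Q) → Prop
  | [] => True
  | a :: as => a.arityOK prm m ∧ arityOKL prm m as
end

mutual
/-- No stay move: no call `q'(x₀)` occurs. -/
def noStay : RHS Q → Prop
  | .eps => True
  | .node _ c r => c.noStay ∧ r.noStay
  | .tnode c r => c.noStay ∧ r.noStay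
  | .param _ r => r.noStay
  | .call _ x args r => x ≠ .x0 ∧ noStayL args ∧ r.noStay
def noStayL : List (RHS Q) → Prop
  | [] => True
  | a :: as => a.noStay ∧ noStayL as
end

mutual
/-- The right-hand side is a **tree** in which every labeled node is binary
(reading `node l c r` as the binary node `l(c,r)`); parameters and state calls
occur as leaves of this tree (empty continuation). -/
def isTree : RHS Q → Prop
  | .eps => True
  | .node _ c r => c.isTree ∧ r.isTree
  | .tnode c r => c.isTree ∧ r.isTree
  | .param _ r => r = .eps
  | .call _ _ args r => isTreeL args ∧ r = .eps
def isTreeL : List (RHS Q) → Prop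
  | [] => True
  | a :: as => a.isTree ∧ isTreeL as
end

end RHS

/-- A macro forest transducer (MFT) over the finite set `sig ⊆ U⁺` of symbols:
a finite ranked set `Q` of states (state `q` has `prm q` accumulating
parameters, i.e. rank `prm q + 1`), an initial state `q0` of rank 1, and for
every state at most one `(q,σ)`-rule per symbol `σ ∈ sig`, exactly one ε-rule
and exactly one default rule. -/
structure MFT where
  Q : Type
  [fintypeQ : Fintype Q]
  [deceqQ : DecidableEq Q]
  prm : Q → ℕ
  q0 : Q
  sig : Finset Label
  ruleSym : Q → Label → Option (RHS Q)
  ruleEps : Q → RHS Q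
  ruleDef : Q → RHS Q

attribute [instance] MFT.fintypeQ MFT.deceqQ

/-- Well-formedness of an MFT, as required by the definition: the initial state
has rank 1; `(q,σ)`-rules only for `σ ∈ sig`; `(q,σ)`-rules contain no `%t`;
ε-rules contain no `%t` and use only the input variable `x0`; all labels in
right-hand sides are symbols of `sig`; all rules respect the ranks of states. -/
def MFT.WF (M : MFT) : Prop :=
  M.prm M.q0 = 0 ∧
  (∀ q a, a ∉ M.sig → M.ruleSym q a = none) ∧
  (∀ q a r, M.ruleSym q a = some r →
      r.noT ∧ r.labelsIn M.sig ∧ r.arityOK M.prm (M.prm q)) ∧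
  (∀ q : M.Q, (M.ruleEps q).noT ∧ (M.ruleEps q).varsOnly0 ∧
      (M.ruleEps q).labelsIn M.sig ∧ (M.ruleEps q).arityOK M.prm (M.prm q)) ∧
  (∀ q : M.Q, (M.ruleDef q).labelsIn M.sig ∧ (M.ruleDef q).arityOK M.prm (M.prm q))

mutual
/-- Big-step semantics of states: `Eval M q g ys out` means
`⟦q⟧(g, ys) = out`: the unique applicable rule of `q` on input `g` is chosen
(the ε-rule if `g = ε`, the `(q,σ)`-rule if `g = σ(g₁)g₂` and it exists,
otherwise the default rule) and its right-hand side evaluated. -/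
inductive Eval (M : MFT) : M.Q → Forest → List Forest → Forest → Prop where
  | eps : ∀ (q : M.Q) (ys : List Forest) (out : Forest),
      EvalR M (M.ruleEps q) .eps .eps .eps none ys out →
      Eval M q .eps ys out
  | sym : ∀ (q : M.Q) (l : Label) (c r : Forest) (rh : RHS M.Q) ys out,
      M.ruleSym q l = some rh →
      EvalR M rh (.node l c r) c r (some l) ys out →
      Eval M q (.node l c r) ys out
  | dflt : ∀ (q : M.Q) (l : Label) (c r : Forest) ys out,
      M.ruleSym q l = none →
      EvalR M (M.ruleDef q) (.node l c r) c r (some l) ys out →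
      Eval M q (.node l c r) ys out

/-- Evaluation of right-hand sides: `EvalR M rh g0 g1 g2 lab ys out`; here `g0`
is bound to `x0`, `g1` to `x1`, `g2` to `x2`, `lab` is the label of the current
node (for `%t`-nodes), and `ys` are the values of the parameters. -/
inductive EvalR (M : MFT) : RHS M.Q → Forest → Forest → Forest → Option Label →
    List Forest → Forest → Prop where
  | eps : ∀ g0 g1 g2 lab ys, EvalR M .eps g0 g1 g2 lab ys .eps
  | node : ∀ (l : Label) c r g0 g1 g2 lab ys oc orr,
      EvalR M c g0 g1 g2 lab ys oc → EvalR M r g0 g1 g2 lab ys orr →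
      EvalR M (.node l c r) g0 g1 g2 lab ys (.node l oc orr)
  | tnode : ∀ (l : Label) c r g0 g1 g2 ys oc orr,
      EvalR M c g0 g1 g2 (some l) ys oc → EvalR M r g0 g1 g2 (some l) ys orr →
      EvalR M (.tnode c r) g0 g1 g2 (some l) ys (.node l oc orr)
  | param : ∀ (j : ℕ) r g0 g1 g2 lab ys orr,
      EvalR M r g0 g1 g2 lab ys orr →
      EvalR M (.param j r) g0 g1 g2 lab ys ((ys.getD j .eps).append orr)
  | call : ∀ (p : M.Q) (x : XVar) args cont g0 g1 g2 lab ys vs oq orr,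
      EvalL M args g0 g1 g2 lab ys vs →
      Eval M p (x.sel g0 g1 g2) vs oq →
      EvalR M cont g0 g1 g2 lab ys orr →
      EvalR M (.call p x args cont) g0 g1 g2 lab ys (oq.append orr)

/-- Pointwise evaluation of the parameter-argument list of a state call. -/
inductive EvalL (M : MFT) : List (RHS M.Q) → Forest → Forest → Forest →
    Option Label → List Forest → List Forest → Prop where
  | nil : ∀ g0 g1 g2 lab ys, EvalL M [] g0 g1 g2 lab ys []
  | cons : ∀ a as g0 g1 g2 lab ys v vs,
      EvalR M a g0 g1 g2 lab ys v → EvalL M as g0 g1 g2 lab ys vs →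
      EvalL M (a :: as) g0 g1 g2 lab ys (v :: vs)
end

/-- The translation realized by `M`: `⟦M⟧(f) = ⟦q₀⟧(f)` (as a binary relation;
for terminating MFTs this relation is a total function). -/
def MFT.Sem (M : MFT) : Forest → Forest → Prop :=
  fun f g => Eval M M.q0 f [] g

/-- `M` is terminating: every state on every input with every parameter
assignment produces exactly one output. -/
def MFT.Terminating (M : MFT) : Prop :=
  ∀ (q : M.Q) (f : Forest) (ys : List Forest), ∃! out, Eval M q f ys out

/-- Size of a transducer: `|sig|` plus the sum of the sizes of all left-hand
sides and right-hand sides of its rules. -/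
def MFT.size (M : MFT) : ℕ :=
  M.sig.card +
    ∑ q : M.Q, ((M.prm q + 2) + (M.ruleEps q).size
      + ((M.prm q + 4) + (M.ruleDef q).size)
      + ∑ a ∈ M.sig, ((M.ruleSym q a).elim 0 fun r => (M.prm q + 4) + r.size))

/-- A forest transducer (FT): an MFT all of whose states have rank 1
(no accumulating parameters). -/
def MFT.IsFT (M : MFT) : Prop := ∀ q : M.Q, M.prm q = 0

/-- A macro tree transducer (MTT): an MFT whose rule right-hand sides are trees
in which every `Σ∪{%t}`-labeled node is binary. -/
def MFT.IsMTT (M : MFT) : Prop :=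
  (∀ q a r, M.ruleSym q a = some r → r.isTree) ∧
  (∀ q : M.Q, (M.ruleEps q).isTree ∧ (M.ruleDef q).isTree)

/-- A top-down tree transducer (TT): an FT that is an MTT. -/
def MFT.IsTT (M : MFT) : Prop := M.IsFT ∧ M.IsMTT

/-- `M` contains no stay moves. -/
def MFT.NoStay (M : MFT) : Prop :=
  (∀ q a r, M.ruleSym q a = some r → r.noStay) ∧
  (∀ q : M.Q, (M.ruleEps q).noStay ∧ (M.ruleDef q).noStay)

/-- Composition of translations (apply `T1` first, then `T2`). -/
def TransComp (T1 T2 : Forest → Forest → Prop) : Forest → Forest → Prop :=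
  fun f g => ∃ h, T1 f h ∧ T2 h g

/-! ## Stay move removal: inlining a state all of whose rules are
`q(%, y₁,…,y_m) → r` with `r` not containing `x₁`, `x₂`. -/

namespace StayRemoval

variable (M : MFT) (q : M.Q)

/-- The state set of the transducer obtained by deleting the state `q`. -/
abbrev Q' : Type := {p : M.Q // p ≠ q}

/-- Re-interpret the inlined right-hand side `r` of the deleted state `q` at a
call site `q(x, e₁, …, e_m)`: the input variable `x₀` of `r` is replaced by
`x`, each parameter `y_j` of `r` is replaced by the (already converted)
argument `e_j`, and states are re-indexed (a call to `q` itself cannot occur in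
`r` under the hypotheses; it is mapped to `ε`). -/
def conv (x : XVar) (es : List (RHS (Q' M q))) : RHS M.Q → RHS (Q' M q)
  | .eps => .eps
  | .node l c r => .node l (conv x es c) (conv x es r)
  | .tnode c r => .tnode (conv x es c) (conv x es r)
  | .param j r => (es.getD j .eps).append (conv x es r)
  | .call p x' as cont =>
      if h : p = q then .eps
      else .call ⟨p, h⟩ (if x' = XVar.x0 then x else x')
        ((as.attach.map fun a => conv x es a.1)) (conv x es cont)
decreasing_by
  all_goals simp_wf
  all_goals try omega
  all_goals (have := List.sizeOf_lt_of_mem a.2; omega)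

variable (r0 : RHS M.Q)

/-- Replace, in a right-hand side of `M`, each call `q(x, e₁, …, e_m)` to the
deleted state `q` by `r0` with `x₀` replaced by `x` and each `y_j` replaced by
`e_j`. -/
def inline : RHS M.Q → RHS (Q' M q)
  | .eps => .eps
  | .node l c r => .node l (inline c) (inline r)
  | .tnode c r => .tnode (inline c) (inline r)
  | .param j r => .param j (inline r)
  | .call p x as cont =>
      if _ : p = q then
        (conv M q x (as.attach.map fun a => inline a.1) r0).append (inline cont)
      else
        .call ⟨p, ‹p ≠ q›⟩ x (as.attach.map fun a => inline a.1) (inline cont)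
decreasing_by
  all_goals simp_wf
  all_goals try omega
  all_goals (have := List.sizeOf_lt_of_mem a.2; omega)

variable (hq0 : M.q0 ≠ q)

/-- The transducer `M'` obtained from `M` by deleting the state `q` and its
rules and inlining `r0` at every call to `q` in the remaining right-hand
sides. -/
def removeStay : MFT where
  Q := Q' M q
  prm := fun p => M.prm p.val
  q0 := ⟨M.q0, hq0⟩
  sig := M.sig
  ruleSym := fun p a => (M.ruleSym p.val a).map (inline M q r0)
  ruleEps := fun p => inline M q r0 (M.ruleEps p.val)
  ruleDef := fun p => inline M q r0 (M.ruleDef p.val)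

end StayRemoval

theorem Forest.append_assoc (a b c : Forest) :
    (a.append b).append c = a.append (b.append c) := by
  induction a with
  | eps => rfl
  | node l _ _ _ ih => simp [Forest.append, ih]

mutual
/-- The state `q` is not called in the right-hand side. -/
def RHS.noCall (q : Q) : RHS Q → Prop
  | .eps => True
  | .node _ c r => c.noCall q ∧ r.noCall q
  | .tnode c r => c.noCall q ∧ r.noCall q
  | .param _ r => r.noCall q
  | .call p _ args r => p ≠ q ∧ RHS.noCallL q args ∧ r.noCall q
/-- The state `q` is not called in any of the right-hand sides. -/
def RHS.noCallL (q : Q) : List (RHS Q) → Prop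
  | [] => True
  | a :: as => a.noCall q ∧ RHS.noCallL q as
end

/-! ### Determinism of evaluation -/

mutual
theorem Eval.det {M : MFT} {p : M.Q} {f ys out out'} :
    Eval M p f ys out → Eval M p f ys out' → out = out'
  | .eps _ _ _ h, h' => by
    cases h' with
    | eps _ _ _ h' => exact h.det h'
  | .sym _ _ _ _ _ _ _ e h, h' => by
    cases h' with
    | sym _ _ _ _ _ _ _ e' h' =>
      obtain rfl := Option.some.inj (e.symm.trans e')
      exact h.det h'
    | dflt _ _ _ _ _ _ e' _ => cases e.symm.trans e'
  | .dflt _ _ _ _ _ _ e h, h' => by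
    cases h' with
    | sym _ _ _ _ _ _ _ e' _ => cases e.symm.trans e'
    | dflt _ _ _ _ _ _ _ h' => exact h.det h'

theorem EvalR.det {M : MFT} {rh : RHS M.Q} {g0 g1 g2 lab ys out out'} :
    EvalR M rh g0 g1 g2 lab ys out → EvalR M rh g0 g1 g2 lab ys out' → out = out'
  | .eps .., h' => by cases h'; rfl
  | .node _ _ _ _ _ _ _ _ _ _ hc hr, h' => by
    cases h' with
    | node _ _ _ _ _ _ _ _ _ _ hc' hr' => rw [hc.det hc', hr.det hr']
  | .tnode _ _ _ _ _ _ _ _ _ hc hr, h' => by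
    cases h' with
    | tnode _ _ _ _ _ _ _ _ _ hc' hr' => rw [hc.det hc', hr.det hr']
  | .param _ _ _ _ _ _ _ _ hr, h' => by
    cases h' with
    | param _ _ _ _ _ _ _ _ hr' => rw [hr.det hr']
  | .call _ _ _ _ _ _ _ _ _ _ _ _ ha hq hr, h' => by
    cases h' with
    | call _ _ _ _ _ _ _ _ _ _ _ _ ha' hq' hr' =>
      obtain rfl := ha.det ha'
      rw [hq.det hq', hr.det hr']

theorem EvalL.det {M : MFT} {as : List (RHS M.Q)} {g0 g1 g2 lab ys vs vs'} :
    EvalL M as g0 g1 g2 lab ys vs → EvalL M as g0 g1 g2 lab ys vs' → vs = vs'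
  | .nil .., h' => by cases h'; rfl
  | .cons _ _ _ _ _ _ _ _ _ ha has, h' => by
    cases h' with
    | cons _ _ _ _ _ _ _ _ _ ha' has' => rw [ha.det ha', has.det has']
end

/-! ### Evaluation of concatenations and of argument lists -/

theorem EvalR.append {M : MFT} {t : RHS M.Q} {g0 g1 g2 lab ys ot}
    (ht : EvalR M t g0 g1 g2 lab ys ot) :
    ∀ {s : RHS M.Q} {os}, EvalR M s g0 g1 g2 lab ys os →
      EvalR M (s.append t) g0 g1 g2 lab ys (os.append ot)
  | _, _, .eps .. => by simpa only [RHS.append, Forest.append] using ht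
  | _, _, .node _ _ _ _ _ _ _ _ _ _ hc hr => by
    simpa only [RHS.append, Forest.append] using
      EvalR.node _ _ _ _ _ _ _ _ _ _ hc (EvalR.append ht hr)
  | _, _, .tnode _ _ _ _ _ _ _ _ _ hc hr => by
    simpa only [RHS.append, Forest.append] using
      EvalR.tnode _ _ _ _ _ _ _ _ _ hc (EvalR.append ht hr)
  | _, _, .param _ _ _ _ _ _ _ _ hr => by
    simpa only [RHS.append, Forest.append_assoc] using
      EvalR.param _ _ _ _ _ _ _ _ (EvalR.append ht hr)
  | _, _, .call _ _ _ _ _ _ _ _ _ _ _ _ ha hq hr => by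
    simpa only [RHS.append, Forest.append_assoc] using
      EvalR.call _ _ _ _ _ _ _ _ _ _ _ _ ha hq (EvalR.append ht hr)

theorem EvalL.getD {M : MFT} {g0 g1 g2 lab ys} :
    ∀ {es : List (RHS M.Q)} {vs}, EvalL M es g0 g1 g2 lab ys vs → ∀ j : ℕ,
      EvalR M (es.getD j .eps) g0 g1 g2 lab ys (vs.getD j .eps)
  | _, _, .nil .., j => by simpa using EvalR.eps ..
  | _, _, .cons _ _ _ _ _ _ _ _ _ ha _, 0 => by simpa using ha
  | _, _, .cons _ _ _ _ _ _ _ _ _ _ has, j + 1 => by simpa using EvalL.getD has j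

/-! ### A state with a defined value does not call itself on the whole input -/

section NoCall

variable {M : MFT} {q : M.Q} {r0 : RHS M.Q}

mutual
theorem Eval.noCall_rule (hsym : ∀ a, M.ruleSym q a = none) (heps : M.ruleEps q = r0)
    (hdef : M.ruleDef q = r0)
    {p f ys out} : Eval M p f ys out → p = q → r0.noCall q
  | .eps _ _ _ h, e => by
    have ih := EvalR.noCall_rule hsym heps hdef h
    rw [e, heps] at ih
    exact ih.elim id id
  | .sym _ _ _ _ _ _ _ e' _, e => by
    subst e
    cases (hsym _).symm.trans e'
  | .dflt _ _ _ _ _ _ _ h, e => by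
    have ih := EvalR.noCall_rule hsym heps hdef h
    rw [e, hdef] at ih
    exact ih.elim id id

theorem EvalR.noCall_rule (hsym : ∀ a, M.ruleSym q a = none) (heps : M.ruleEps q = r0)
    (hdef : M.ruleDef q = r0)
    {rh : RHS M.Q} {g0 g1 g2 lab ys out} :
    EvalR M rh g0 g1 g2 lab ys out → r0.noCall q ∨ rh.noCall q
  | .eps .. => by simp [RHS.noCall]
  | .node _ _ _ _ _ _ _ _ _ _ hc hr => by
    have h1 := EvalR.noCall_rule hsym heps hdef hc
    have h2 := EvalR.noCall_rule hsym heps hdef hr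
    simp only [RHS.noCall]; tauto
  | .tnode _ _ _ _ _ _ _ _ _ hc hr => by
    have h1 := EvalR.noCall_rule hsym heps hdef hc
    have h2 := EvalR.noCall_rule hsym heps hdef hr
    simp only [RHS.noCall]; tauto
  | .param _ _ _ _ _ _ _ _ hr => by
    simpa only [RHS.noCall] using EvalR.noCall_rule hsym heps hdef hr
  | .call _ _ _ _ _ _ _ _ _ _ _ _ ha hq hr => by
    have h1 := EvalL.noCall_rule hsym heps hdef ha
    have h2 := Eval.noCall_rule hsym heps hdef hq
    have h3 := EvalR.noCall_rule hsym heps hdef hr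
    simp only [RHS.noCall]; tauto

theorem EvalL.noCall_rule (hsym : ∀ a, M.ruleSym q a = none) (heps : M.ruleEps q = r0)
    (hdef : M.ruleDef q = r0)
    {as : List (RHS M.Q)} {g0 g1 g2 lab ys vs} :
    EvalL M as g0 g1 g2 lab ys vs → r0.noCall q ∨ RHS.noCallL q as
  | .nil .. => by simp [RHS.noCallL]
  | .cons _ _ _ _ _ _ _ _ _ ha has => by
    have h1 := EvalR.noCall_rule hsym heps hdef ha
    have h2 := EvalL.noCall_rule hsym heps hdef has
    simp only [RHS.noCallL]; tauto
end

end NoCall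

/-! ### The transducer without `q` simulates the original one -/

namespace StayRemoval

variable {M : MFT} {q : M.Q} {r0 : RHS M.Q} {hq0 : M.q0 ≠ q}

/-- Replacing each parameter of `rh` by an argument with the same value, and `x₀` by a variable
with the same value, yields a right-hand side evaluating to `out`. -/
def ConvEval (M : MFT) (q : M.Q) (r0 : RHS M.Q) (hq0 : M.q0 ≠ q) (rh : RHS M.Q) (f : Forest)
    (ys : List Forest) (out : Forest) : Prop :=
  ∀ (x : XVar) (es : List (RHS (Q' M q))) g0 g1 g2 lab zs, x.sel g0 g1 g2 = f →
    EvalL (removeStay M q r0 hq0) es g0 g1 g2 lab zs ys →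
    EvalR (removeStay M q r0 hq0) (conv M q x es rh) g0 g1 g2 lab zs out

mutual
theorem eval_removeStay (hsym : ∀ a, M.ruleSym q a = none) (heps : M.ruleEps q = r0)
    (hdef : M.ruleDef q = r0) (hT : r0.noT) (hv : r0.varsOnly0) (hc : r0.noCall q) {p f ys out} :
    Eval M p f ys out →
      (∀ h : p ≠ q, Eval (removeStay M q r0 hq0) ⟨p, h⟩ f ys out) ∧
      (p = q → ConvEval M q r0 hq0 r0 f ys out)
  | .eps _ _ _ h =>
    have ih := evalR_removeStay hsym heps hdef hT hv hc h
    ⟨fun _ => .eps _ _ _ ih.1, fun e => by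
      subst e; rw [heps] at ih; exact ih.2 hT hv hc⟩
  | .sym _ _ _ _ _ _ _ e' h =>
    have ih := evalR_removeStay hsym heps hdef hT hv hc h
    ⟨fun _ => .sym _ _ _ _ _ _ _ (by simp [removeStay, e']) ih.1, fun e => by
      subst e; cases (hsym _).symm.trans e'⟩
  | .dflt _ _ _ _ _ _ e' h =>
    have ih := evalR_removeStay hsym heps hdef hT hv hc h
    ⟨fun _ => .dflt _ _ _ _ _ _ (by simp [removeStay, e']) ih.1, fun e => by
      subst e; rw [hdef] at ih; exact ih.2 hT hv hc⟩

theorem evalR_removeStay (hsym : ∀ a, M.ruleSym q a = none) (heps : M.ruleEps q = r0)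
    (hdef : M.ruleDef q = r0) (hT : r0.noT) (hv : r0.varsOnly0) (hc : r0.noCall q)
    {rh : RHS M.Q} {g0 g1 g2 lab ys out} :
    EvalR M rh g0 g1 g2 lab ys out →
      EvalR (removeStay M q r0 hq0) (inline M q r0 rh) g0 g1 g2 lab ys out ∧
      (rh.noT → rh.varsOnly0 → rh.noCall q → ConvEval M q r0 hq0 rh g0 ys out)
  | .eps .. => by
    refine ⟨?_, fun _ _ _ x es g0 g1 g2 lab zs _ _ => ?_⟩
    · rw [inline]; exact .eps ..
    · rw [conv]; exact .eps ..
  | .node _ _ _ _ _ _ _ _ _ _ h1 h2 => by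
    have ih1 := evalR_removeStay hsym heps hdef hT hv hc h1
    have ih2 := evalR_removeStay hsym heps hdef hT hv hc h2
    refine ⟨?_, fun nt vo nc x es g0 g1 g2 lab zs hx hes => ?_⟩
    · rw [inline]; exact .node _ _ _ _ _ _ _ _ _ _ ih1.1 ih2.1
    · rw [conv]
      exact .node _ _ _ _ _ _ _ _ _ _
        (ih1.2 nt.1 vo.1 nc.1 x es g0 g1 g2 lab zs hx hes)
        (ih2.2 nt.2 vo.2 nc.2 x es g0 g1 g2 lab zs hx hes)
  | .tnode _ _ _ _ _ _ _ _ _ h1 h2 => by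
    have ih1 := evalR_removeStay hsym heps hdef hT hv hc h1
    have ih2 := evalR_removeStay hsym heps hdef hT hv hc h2
    refine ⟨?_, fun nt => nt.elim⟩
    rw [inline]; exact .tnode _ _ _ _ _ _ _ _ _ ih1.1 ih2.1
  | .param _ _ _ _ _ _ _ _ h => by
    have ih := evalR_removeStay hsym heps hdef hT hv hc h
    refine ⟨?_, fun nt vo nc x es g0 g1 g2 lab zs hx hes => ?_⟩
    · rw [inline]; exact .param _ _ _ _ _ _ _ _ ih.1
    · rw [conv]
      exact .append (ih.2 nt vo nc x es g0 g1 g2 lab zs hx hes) (hes.getD _)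
  | .call p x' _ _ _ _ _ _ _ _ _ _ ha hq hr => by
    have iha := evalL_removeStay hsym heps hdef hT hv hc ha
    have ihq := eval_removeStay hsym heps hdef hT hv hc hq
    have ihr := evalR_removeStay hsym heps hdef hT hv hc hr
    refine ⟨?_, fun nt vo nc x es g0 g1 g2 lab zs hx hes => ?_⟩
    · rw [inline, List.attach_map_val]
      split_ifs with h
      · exact .append ihr.1 (ihq.2 h _ _ _ _ _ _ _ rfl iha.1)
      · exact .call _ _ _ _ _ _ _ _ _ _ _ _ iha.1 (ihq.1 h) ihr.1
    · obtain ⟨rfl, va, vr⟩ := vo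
      rw [conv, dif_neg nc.1, if_pos rfl, List.attach_map_val]
      refine .call _ _ _ _ _ _ _ _ _ _ _ _
        (iha.2 nt.1 va nc.2.1 x es g0 g1 g2 lab zs hx hes) ?_
        (ihr.2 nt.2 vr nc.2.2 x es g0 g1 g2 lab zs hx hes)
      rw [hx]
      exact ihq.1 nc.1

theorem evalL_removeStay (hsym : ∀ a, M.ruleSym q a = none) (heps : M.ruleEps q = r0)
    (hdef : M.ruleDef q = r0) (hT : r0.noT) (hv : r0.varsOnly0) (hc : r0.noCall q)
    {as : List (RHS M.Q)} {g0 g1 g2 lab ys vs} :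
    EvalL M as g0 g1 g2 lab ys vs →
      EvalL (removeStay M q r0 hq0) (as.map (inline M q r0)) g0 g1 g2 lab ys vs ∧
      (RHS.noTL as → RHS.varsOnly0L as → RHS.noCallL q as →
        ∀ (x : XVar) (es : List (RHS (Q' M q))) g0' g1' g2' lab' zs, x.sel g0' g1' g2' = g0 →
          EvalL (removeStay M q r0 hq0) es g0' g1' g2' lab' zs ys →
          EvalL (removeStay M q r0 hq0) (as.map (conv M q x es)) g0' g1' g2' lab' zs vs)
  | .nil .. => ⟨.nil .., fun _ _ _ _ _ _ _ _ _ _ _ _ => .nil ..⟩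
  | .cons _ _ _ _ _ _ _ _ _ ha has =>
    have iha := evalR_removeStay hsym heps hdef hT hv hc ha
    have ihas := evalL_removeStay hsym heps hdef hT hv hc has
    ⟨.cons _ _ _ _ _ _ _ _ _ iha.1 ihas.1, fun nt vo nc x es g0 g1 g2 lab zs hx hes =>
      .cons _ _ _ _ _ _ _ _ _
        (iha.2 nt.1 vo.1 nc.1 x es g0 g1 g2 lab zs hx hes)
        (ihas.2 nt.2 vo.2 nc.2 x es g0 g1 g2 lab zs hx hes)⟩
end

end StayRemoval

/-- Stay move removal preserves semantics: let `M` be a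
terminating MFT and `q` a non-initial state all of whose rules (the ε-rule and
the default rule; there are no `σ`-rules for `q`) have the same right-hand side
`r` in which neither `x₁` nor `x₂` occurs.  Let `M'` be obtained from `M` by
deleting the state `q` and its rules and replacing, in every remaining
right-hand side, each call `q(x_i, e₁, …, e_m)` by `r` with `x₀` replaced by
`x_i` and each `y_j` replaced by `e_j`.  Then `⟦M'⟧ = ⟦M⟧`. -/
theorem stay_move_removal_preserves_semantics :
    ∀ (M : MFT) (q : M.Q) (hq0 : M.q0 ≠ q) (r : RHS M.Q),
      M.WF → M.Terminating →
      (∀ a : Label, M.ruleSym q a = none) →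
      M.ruleEps q = r → M.ruleDef q = r →
      r.varsOnly0 →
      (StayRemoval.removeStay M q r hq0).Sem = M.Sem := by
  intro M q hq0 r hwf hterm hsym heps hdef hv
  have hT : r.noT := heps ▸ (hwf.2.2.2.1 q).1
  obtain ⟨o, ho, -⟩ := hterm q .eps []
  have hc := ho.noCall_rule hsym heps hdef rfl
  have sim : ∀ f g, M.Sem f g → (StayRemoval.removeStay M q r hq0).Sem f g := fun f g h =>
    (StayRemoval.eval_removeStay hsym heps hdef hT hv hc h).1 hq0
  funext f g
  refine propext ⟨fun h => ?_, sim f g⟩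
  obtain ⟨out, hout, -⟩ := hterm M.q0 f []
  obtain rfl : g = out := Eval.det h (sim f out hout)
  exact hout
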